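/- Let X and Y be smooth projective curves over a field k and let π : X → Y be a dominant k-rational map. Then gon_k(X) ≥ gon_k(Y). -/

import Mathlib

/-!
We model a smooth projective (geometrically integral) curve over a field `k` by its
function field `K`, a finitely generated extension of `k` of transcendence degree `1`.
A non-constant `k`-rational morphism `C → ℙ¹` of degree `n` corresponds exactly to an
element `f ∈ K` that is transcendental over `k` with `[K : k(f)] = n`.
-/

/-- `K` is the function field of a smooth projective curve over `k`:
a finitely generated extension of transcendence degree `1`. -/
def IsFunctionField (k K : Type*) [Field k] [Field K] [Algebra k K] : Prop :=
  ∃ x : K, Transcendental k x ∧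
    FiniteDimensional ↥(IntermediateField.adjoin k {x}) K

/-- The `k`-gonality of the curve with function field `K`: the least degree
`[K : k(f)]` of a non-constant morphism to `ℙ¹`, i.e. of a transcendental `f ∈ K`. -/
noncomputable def gonality (k K : Type*) [Field k] [Field K] [Algebra k K] : ℕ :=
  sInf {n | ∃ f : K, Transcendental k f ∧
    Module.finrank ↥(IntermediateField.adjoin k {f}) K = n}


namespace GonAux

open Polynomial

lemma exists_max_coeff {L Γ : Type*} [Field L] [LinearOrderedCommGroupWithZero Γ]
    (v : Valuation L Γ) (P : L[X]) :
    ∃ i₀, (∀ i, v (P.coeff i) ≤ v (P.coeff i₀)) ∧ ∀ i < i₀, v (P.coeff i) < v (P.coeff i₀) := by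
  classical
  have h1 : ∃ i₀, ∀ i, v (P.coeff i) ≤ v (P.coeff i₀) := by
    obtain ⟨i₀, -, h⟩ := Finset.exists_max_image (Finset.range (P.natDegree + 1))
      (fun i => v (P.coeff i)) ⟨0, by simp⟩
    refine ⟨i₀, fun i => ?_⟩
    by_cases hi : i < P.natDegree + 1
    · exact h i (by simpa using hi)
    · rw [Polynomial.coeff_eq_zero_of_natDegree_lt (by omega)]; simp
  refine ⟨Nat.find h1, Nat.find_spec h1, fun i hi => ?_⟩
  have := Nat.find_min h1 hi
  push Not at this
  obtain ⟨j, hj⟩ := this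
  exact hj.trans_le (Nat.find_spec h1 j)

lemma gauss {L Γ : Type*} [Field L] [LinearOrderedCommGroupWithZero Γ]
    (v : Valuation L Γ) (P H : L[X]) (c : Γ) (h : ∀ t, v ((P * H).coeff t) ≤ c) (i j : ℕ) :
    v (P.coeff i) * v (H.coeff j) ≤ c := by
  classical
  obtain ⟨i₀, hi₁, hi₂⟩ := exists_max_coeff v P
  obtain ⟨j₀, hj₁, hj₂⟩ := exists_max_coeff v H
  refine (mul_le_mul' (hi₁ i) (hj₁ j)).trans ?_
  rcases eq_or_ne (v (P.coeff i₀)) 0 with hP | hP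
  · simp [hP]
  rcases eq_or_ne (v (H.coeff j₀)) 0 with hH | hH
  · simp [hH]
  refine le_trans (le_of_eq ?_) (h (i₀ + j₀))
  rw [Polynomial.coeff_mul, v.map_sum_eq_of_lt (s := Finset.HasAntidiagonal.antidiagonal (i₀ + j₀))
    (f := fun x => P.coeff x.1 * H.coeff x.2) (j := (i₀, j₀)) (by simp), map_mul]
  · rintro ⟨x, y⟩ hxy
    simp only [Finset.mem_sdiff, Finset.HasAntidiagonal.mem_antidiagonal, Finset.mem_singleton, Prod.mk.injEq] at hxy
    simp only [map_mul]
    have : x < i₀ ∨ y < j₀ := by omega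
    rcases this with hx | hy
    · exact (mul_le_mul' le_rfl (hj₁ y)).trans_lt
        (mul_lt_mul_of_pos_right (hi₂ x hx) (zero_lt_iff.mpr hH))
    · exact (mul_le_mul' (hi₁ x) le_rfl).trans_lt
        (mul_lt_mul_of_pos_left (hj₂ y hy) (zero_lt_iff.mpr hP))

lemma exists_place {k L : Type*} [Field k] [Field L] [Algebra k L] {x : L}
    (hx : Transcendental k x) :
    ∃ W : ValuationSubring L, (∀ c : k, algebraMap k L c ∈ W) ∧ x ∉ W := by
  have hx' : x ∉ (integralClosure k L).toSubring := fun h =>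
    hx (IsIntegral.isAlgebraic h)
  have : IsIntegrallyClosedIn (integralClosure k L).toSubring L :=
    inferInstanceAs (IsIntegrallyClosedIn (integralClosure k L) L)
  obtain ⟨V, h1, h2⟩ := Subring.exists_le_valuationSubring_of_isIntegrallyClosedIn hx'
  exact ⟨V, fun c => h1 ((integralClosure k L).algebraMap_mem c), h2⟩

lemma val_le_one_of_alg {k L : Type*} [Field k] [Field L] [Algebra k L] {x : L}
    (hx : IsAlgebraic k x) (W : ValuationSubring L) (hW : ∀ c : k, algebraMap k L c ∈ W) :
    x ∈ W := by
  let : Algebra k W := ((algebraMap k L).codRestrict W hW).toAlgebra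
  have : IsScalarTower k W L := IsScalarTower.of_algebraMap_eq fun _ => rfl
  have : IsIntegral W x := hx.isIntegral.tower_top
  obtain ⟨y, hy⟩ := IsIntegrallyClosed.isIntegral_iff.mp this
  rw [← hy]; exact y.2

section

variable (k : Type*) {L : Type*} [Field k] [Field L] [Algebra k L]

/-- The Riemann–Roch space of `(m-1)` times the pole divisor of `a`. -/
def E (a : L) (m : ℕ) : Submodule k L where
  carrier := {z | ∀ W : ValuationSubring L, (∀ c : k, algebraMap k L c ∈ W) →
    W.valuation z * max 1 (W.valuation a) ≤ max 1 (W.valuation a) ^ m}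
  zero_mem' := by intro W _; simp
  add_mem' := by
    intro x y hx hy W hW
    rcases le_total (W.valuation x) (W.valuation y) with h | h
    · refine le_trans (mul_le_mul_left ((W.valuation.map_add x y).trans ?_) _) (hy W hW)
      simp [h]
    · refine le_trans (mul_le_mul_left ((W.valuation.map_add x y).trans ?_) _) (hx W hW)
      simp [h]
  smul_mem' := by
    intro c x hx W hW
    rw [Algebra.smul_def, map_mul]
    refine le_trans (mul_le_mul_left ?_ _) (hx W hW)
    exact mul_le_of_le_one_left' ((W.valuation_le_one_iff _).mpr (hW c))

lemma E_zero {a : L} (ha : Transcendental k a) : E k a 0 = ⊥ := by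
  rw [eq_bot_iff]
  intro z hz
  by_contra hz0
  have hz0 : z ≠ 0 := hz0
  have hz1 : IsAlgebraic k z := by
    by_contra h
    obtain ⟨W, hW, hz'⟩ := exists_place h
    apply hz'
    rw [← W.valuation_le_one_iff]
    have := hz W hW
    refine le_trans ?_ (this.trans_eq (pow_zero _))
    exact le_mul_of_one_le_right' (le_max_left _ _)
  obtain ⟨W, hW, ha'⟩ := exists_place ha
  have h1 : z⁻¹ ∈ W := val_le_one_of_alg hz1.inv W hW
  apply ha'
  rw [← W.valuation_le_one_iff] at h1 ⊢
  have h2 := hz W hW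
  rw [pow_zero] at h2
  have h3 : W.valuation a ≤ W.valuation z⁻¹ * (W.valuation z * max 1 (W.valuation a)) := by
    rw [← mul_assoc, ← map_mul, inv_mul_cancel₀ hz0, map_one, one_mul]
    exact le_max_right _ _
  exact h3.trans (mul_le_one' h1 h2)

lemma E_gauss {a : L} {m : ℕ} (P H : L[X]) (hP : P.Monic) {i : ℕ} (hi : P.coeff i = a)
    (h : ∀ t, (P * H).coeff t ∈ E k a (m + 1)) (j : ℕ) : H.coeff j ∈ E k a m := by
  intro W hW
  have h0 : (0 : W.ValueGroup) < max 1 (W.valuation a) := zero_lt_one.trans_le (le_max_left _ _)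
  have key : ∀ t, W.valuation ((P * H).coeff t) ≤ max 1 (W.valuation a) ^ m := by
    intro t
    have := h t W hW
    rw [pow_succ] at this
    exact le_of_mul_le_mul_right this h0
  rcases le_total (W.valuation a) 1 with h | h
  · have := gauss W.valuation P H _ key P.natDegree j
    rw [hP.coeff_natDegree, map_one, one_mul] at this
    simpa [max_eq_left h] using this
  · have := gauss W.valuation P H _ key i j
    rw [hi, mul_comm] at this
    simpa [max_eq_right h] using this

lemma bdd_adjoin {a : L} (c : L) (hc : c ∈ Algebra.adjoin k {a}) :
    ∃ D : ℕ, ∀ W : ValuationSubring L, (∀ c : k, algebraMap k L c ∈ W) →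
      W.valuation c ≤ max 1 (W.valuation a) ^ D := by
  have mono : ∀ (W : ValuationSubring L) {m n : ℕ}, m ≤ n →
      max 1 (W.valuation a) ^ m ≤ max 1 (W.valuation a) ^ n :=
    fun W m n h => pow_le_pow_right' (le_max_left _ _) h
  induction hc using Algebra.adjoin_induction with
  | mem x hx =>
    obtain rfl : x = a := hx
    exact ⟨1, fun W _ => by simp⟩
  | algebraMap r => exact ⟨0, fun W hW => by simpa using (W.valuation_le_one_iff _).mpr (hW r)⟩
  | add x y _ _ hx hy =>
    obtain ⟨D, hD⟩ := hx
    obtain ⟨D', hD'⟩ := hy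
    refine ⟨max D D', fun W hW => (W.valuation.map_add x y).trans (max_le ?_ ?_)⟩
    · exact (hD W hW).trans (mono W (le_max_left _ _))
    · exact (hD' W hW).trans (mono W (le_max_right _ _))
  | mul x y _ _ hx hy =>
    obtain ⟨D, hD⟩ := hx
    obtain ⟨D', hD'⟩ := hy
    refine ⟨D + D', fun W hW => ?_⟩
    rw [map_mul, pow_add]
    exact mul_le_mul' (hD W hW) (hD' W hW)

lemma bdd_integral {a : L} (y : L) (hy : IsIntegral (Algebra.adjoin k {a}) y) :
    ∃ D : ℕ, ∀ W : ValuationSubring L, (∀ c : k, algebraMap k L c ∈ W) →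
      W.valuation y ≤ max 1 (W.valuation a) ^ D := by
  obtain ⟨p, hp, hpy⟩ := hy
  choose D hD using fun i => bdd_adjoin k (p.coeff i : L) (p.coeff i).2
  set N := p.natDegree
  refine ⟨(Finset.range N).sup D, fun W hW => ?_⟩
  set M := max 1 (W.valuation a) with hM
  have hM1 : 1 ≤ M := le_max_left _ _
  by_contra! hlt
  have hy1 : 1 < W.valuation y := (one_le_pow_of_one_le' hM1 _).trans_lt hlt
  have hy0 : 0 < W.valuation y := zero_lt_one.trans hy1
  rw [eval₂_eq_sum_range, Finset.sum_range_succ] at hpy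
  have h1 : (algebraMap (Algebra.adjoin k {a}) L) (p.coeff p.natDegree) = 1 := by
    rw [hp.coeff_natDegree, map_one]
  rw [h1, one_mul] at hpy
  have h2 : W.valuation (y ^ N) = W.valuation (∑ x ∈ Finset.range N,
      (algebraMap (Algebra.adjoin k {a}) L) (p.coeff x) * y ^ x) := by
    rw [← Valuation.map_neg]; congr 1
    exact (eq_neg_of_add_eq_zero_left hpy).symm ▸ rfl
  refine absurd h2 (ne_of_gt ?_)
  refine Valuation.map_sum_lt' _ (by rw [map_pow]; exact pow_pos hy0 _) ?_
  intro i hi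
  have hi' : i + 1 ≤ N := Finset.mem_range.mp hi
  rw [map_mul, map_pow, map_pow]
  calc _ ≤ M ^ ((Finset.range N).sup D) * W.valuation y ^ i := by
        refine mul_le_mul_left ((hD i W hW).trans ?_) _
        exact pow_le_pow_right' hM1 (Finset.le_sup (f := D) hi)
    _ < W.valuation y * W.valuation y ^ i := by
        exact mul_lt_mul_of_pos_right hlt (pow_pos hy0 _)
    _ = W.valuation y ^ (i + 1) := (pow_succ' _ _).symm
    _ ≤ _ := pow_le_pow_right' hy1.le hi'


end

open TensorProduct IntermediateField in
open scoped IntermediateField.algebraAdjoinAdjoin in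
lemma E_step {k K L : Type*} [Field k] [Field K] [Field L] [Algebra k K] [Algebra k L]
    [Algebra L K] [IsScalarTower k L K] (f : K) (hf : IsIntegral L f)
    [FiniteDimensional (adjoin k {f}) K]
    {a : L} {i : ℕ} (hi : (minpoly L f).coeff i = a) {m : ℕ}
    [Module.Finite k (E k a m)] :
    Module.rank k (E k a (m + 1)) ≤
      ((Module.finrank (adjoin k {f}) K + Module.finrank k (E k a m) : ℕ) : Cardinal) := by
  classical
  refine rank_le fun s hs => ?_
  set F := adjoin k {f} with hF
  let g : F := AdjoinSimple.gen k f
  have hu : LinearIndependent k (fun j : s => ((j : E k a (m + 1)) : L)) :=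
    hs.map' (E k a (m + 1)).subtype (Submodule.ker_subtype _)
  let b := Module.finBasis k (E k a m)
  let φ : (s → F) →ₗ[F] K := Fintype.linearCombination F
    (fun j : s => algebraMap L K ((j : E k a (m + 1)) : L))
  let θ : (s → F) →ₗ[F] (F ⊗[k] L) := Fintype.linearCombination F
    (fun j : s => (1 : F) ⊗ₜ[k] ((j : E k a (m + 1)) : L))
  have hθ : Function.Injective θ :=
    linearIndependent_iff_injective_fintypeLinearCombination.mp (Module.Flat.linearIndependent_one_tmul hu)
  let iF : F →+* F ⊗[k] L := (Algebra.TensorProduct.includeLeft : F →ₐ[k] F ⊗[k] L).toRingHom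
  let iL : L →+* F ⊗[k] L := (Algebra.TensorProduct.includeRight : L →ₐ[k] F ⊗[k] L).toRingHom
  let Ψ : L[X] →+* F ⊗[k] L := Polynomial.eval₂RingHom iL (iF g)
  have hΨk : ∀ q : k[X], Ψ (q.map (algebraMap k L)) = iF (aeval g q) := by
    intro q
    have h1 : iL.comp (algebraMap k L) = iF.comp (algebraMap k F) := by
      ext c
      simp [iL, iF]
    simp only [Ψ, coe_eval₂RingHom]
    rw [Polynomial.eval₂_map, h1, aeval_def, Polynomial.hom_eval₂]
  let T : Submodule F (F ⊗[k] L) :=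
    Submodule.span F (Set.range fun j => (1 : F) ⊗ₜ[k] ((b j : E k a m) : L))
  have hT : Module.finrank F T ≤ Module.finrank k (E k a m) := by
    have := finrank_range_le_card (R := F) (fun j => (1 : F) ⊗ₜ[k] ((b j : E k a m) : L))
    simpa [Set.finrank] using this
  have : Module.Finite F T := Module.Finite.span_of_finite F (Set.finite_range _)
  have hTmem : ∀ z ∈ E k a m, (1 : F) ⊗ₜ[k] z ∈ T := by
    intro z hz
    have h1 := b.sum_repr ⟨z, hz⟩
    have h2 : z = ∑ j, b.repr ⟨z, hz⟩ j • ((b j : E k a m) : L) := by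
      have := congrArg (E k a m).subtype h1
      rw [map_sum] at this
      exact this.symm
    rw [h2, tmul_sum]
    refine Submodule.sum_mem _ fun j _ => ?_
    rw [tmul_smul, ← algebraMap_smul F]
    exact T.smul_mem _ (Submodule.subset_span ⟨j, rfl⟩)
  let S : Submodule F (F ⊗[k] L) := T.map (LinearMap.mulLeft F (Ψ (minpoly L f)))
  have hS : Module.finrank F S ≤ Module.finrank k (E k a m) :=
    (Submodule.finrank_map_le _ _).trans hT
  have hker : (LinearMap.ker φ).map θ ≤ S := by
    rintro _ ⟨c, hc, rfl⟩
    have hc : φ c = 0 := hc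
    obtain ⟨d, hd⟩ := IsLocalization.exist_integer_multiples_of_finite
      (nonZeroDivisors (Algebra.adjoin k {f})) c
    have hpoly : ∀ y : Algebra.adjoin k {f}, ∃ q : k[X], aeval g q = algebraMap _ F y := by
      intro y
      obtain ⟨q, hq⟩ : (y : K) ∈ (aeval f : k[X] →ₐ[k] K).range := by
        rw [← Algebra.adjoin_singleton_eq_range_aeval]; exact y.2
      refine ⟨q, Subtype.ext ?_⟩
      have h3 : ((aeval g q : F) : K) = aeval f q := by
        have := Polynomial.aeval_algebraMap_apply K g q
        rw [← IntermediateField.algebraMap_apply, ← this]; rfl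
      rw [h3]; exact hq
    choose y hy using hd
    choose q hq using fun j => hpoly (y j)
    have hq' : ∀ j, aeval g (q j) = algebraMap _ F d.1 * c j := fun j => by
      rw [hq, hy, Algebra.smul_def]
    let Q : L[X] := ∑ j : s, (q j).map (algebraMap k L) * C ((j : E k a (m + 1)) : L)
    have hΨQ : Ψ Q = (algebraMap _ F d.1) • θ c := by
      simp only [Q, map_sum, map_mul, hΨk, hq', θ, Fintype.linearCombination_apply,
        Finset.smul_sum]
      refine Finset.sum_congr rfl fun j _ => ?_
      simp [Ψ, iF, iL, smul_tmul', Algebra.smul_def]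
    have hQ0 : aeval f Q = 0 := by
      have : aeval f Q = (algebraMap _ F d.1) • φ c := by
        simp only [Q, map_sum, map_mul, φ, Fintype.linearCombination_apply,
          Finset.smul_sum, aeval_map_algebraMap, aeval_C]
        refine Finset.sum_congr rfl fun j _ => ?_
        rw [smul_smul, ← hq', Algebra.smul_def]
        congr 1
        exact Polynomial.aeval_algebraMap_apply K g (q j)
      rw [this, hc, smul_zero]
    obtain ⟨H, hH⟩ := minpoly.dvd L f hQ0
    have hHE : ∀ j, H.coeff j ∈ E k a m := by
      refine E_gauss k (minpoly L f) H (minpoly.monic hf) hi fun t => ?_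
      rw [← hH]
      simp only [Q, finsetSum_coeff, coeff_mul_C, coeff_map]
      refine Submodule.sum_mem _ fun j _ => ?_
      rw [← Algebra.smul_def]
      exact Submodule.smul_mem _ _ j.1.2
    have hΨH : Ψ H ∈ T := by
      simp only [Ψ, coe_eval₂RingHom, eval₂_eq_sum_range]
      refine Submodule.sum_mem _ fun j _ => ?_
      have : iL (H.coeff j) * iF g ^ j = (g ^ j) • ((1 : F) ⊗ₜ[k] H.coeff j) := by
        simp [iF, iL, smul_tmul']
      rw [this]
      exact T.smul_mem _ (hTmem _ (hHE j))
    have hd0 : algebraMap _ F d.1 ≠ 0 := by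
      simp
    have h5 : (algebraMap _ F d.1) • θ c ∈ S := by
      rw [← hΨQ, hH, map_mul]
      exact ⟨Ψ H, hΨH, rfl⟩
    exact (S.smul_mem_iff hd0).mp h5
  have h1 : Module.finrank F (LinearMap.ker φ) ≤ Module.finrank k (E k a m) := by
    rw [(Submodule.equivMapOfInjective θ hθ (LinearMap.ker φ)).finrank_eq]
    exact (Submodule.finrank_mono hker).trans hS
  have h2 := LinearMap.finrank_range_add_finrank_ker φ
  have h3 : Module.finrank F (LinearMap.range φ) ≤ Module.finrank F K := Submodule.finrank_le _
  rw [Module.finrank_fintype_fun_eq_card, Fintype.card_coe] at h2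
  omega

open IntermediateField in
lemma E_rank {k K L : Type*} [Field k] [Field K] [Field L] [Algebra k K] [Algebra k L]
    [Algebra L K] [IsScalarTower k L K] (f : K) (hf : IsIntegral L f)
    [FiniteDimensional (adjoin k {f}) K]
    {a : L} (ha : Transcendental k a) {i : ℕ} (hi : (minpoly L f).coeff i = a) (m : ℕ) :
    Module.Finite k (E k a m) ∧
      Module.finrank k (E k a m) ≤ Module.finrank (adjoin k {f}) K * m := by
  induction m with
  | zero =>
    rw [E_zero k ha]
    exact ⟨inferInstance, by simp⟩
  | succ m ih =>
    obtain ⟨ih1, ih2⟩ := ih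
    have h := E_step (k := k) f hf hi (m := m)
    refine ⟨Module.rank_lt_aleph0_iff.mp (h.trans_lt (Cardinal.natCast_lt_aleph0)), ?_⟩
    have := Module.finrank_le_of_rank_le h
    rw [mul_add]; omega

open IntermediateField in
open scoped IntermediateField.algebraAdjoinAdjoin in
lemma finrank_le {k K L : Type*} [Field k] [Field K] [Field L] [Algebra k K] [Algebra k L]
    [Algebra L K] [IsScalarTower k L K] (f : K) (hf : IsIntegral L f)
    [FiniteDimensional (adjoin k {f}) K]
    {a : L} (ha : Transcendental k a) {i : ℕ} (hi : (minpoly L f).coeff i = a) :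
    Module.finrank (adjoin k {a}) L ≤ Module.finrank (adjoin k {f}) K := by
  set n := Module.finrank (adjoin k {f}) K
  rcases Nat.eq_zero_or_pos (Module.finrank (adjoin k {a}) L) with h0 | h0
  · omega
  have : FiniteDimensional (adjoin k {a}) L := Module.finite_of_finrank_pos h0
  set r := Module.finrank (adjoin k {a}) L
  let b := Module.finBasis (adjoin k {a}) L
  have halg : Algebra.IsAlgebraic (Algebra.adjoin k {a}) L :=
    Algebra.IsAlgebraic.trans (Algebra.adjoin k {a}) (adjoin k {a}) L
  choose c hc0 hc using fun j => (halg.isAlgebraic (b j)).exists_integral_multiple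
  have hc0' : ∀ j, algebraMap _ (adjoin k {a}) (c j) ≠ 0 := fun j => by simpa using hc0 j
  have hind : LinearIndependent (adjoin k {a}) (fun j => c j • b j) := by
    have := b.linearIndependent.units_smul (fun j => Units.mk0 _ (hc0' j))
    convert this using 2 with j
    simp [Units.smul_def]
  choose D hD using fun j => bdd_integral k _ (hc j)
  set D₀ := Finset.univ.sup D
  have hpow : LinearIndependent k (fun j : ℕ => (AdjoinSimple.gen k a) ^ j) := by
    have h := (Polynomial.basisMonomials k).linearIndependent.map'
      (aeval (AdjoinSimple.gen k a)).toLinearMap ?_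
    · have e : (⇑(aeval (AdjoinSimple.gen k a) : k[X] →ₐ[k] adjoin k {a}).toLinearMap ∘
          ⇑(Polynomial.basisMonomials k)) = fun j : ℕ => (AdjoinSimple.gen k a) ^ j := by
        funext j; simp
      rw [e] at h
      exact h
    · rw [LinearMap.ker_eq_bot]
      refine transcendental_iff_injective.mp ?_
      intro h
      exact ha (h.algHom (adjoin k {a}).val)
  have key : ∀ N, r * (N + 1) ≤ n * (D₀ + N + 1) := by
    intro N
    obtain ⟨e1, e2⟩ := E_rank f hf ha hi (D₀ + N + 1)
    have hli := linearIndependent_smul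
      (hpow.comp (fun j : Fin (N + 1) => (j : ℕ)) Fin.val_injective) hind
    have hmem : ∀ p : Fin (N + 1) × Fin r,
        (AdjoinSimple.gen k a ^ (p.1 : ℕ)) • (c p.2 • b p.2) ∈ E k a (D₀ + N + 1) := by
      rintro ⟨p, j⟩ W hW
      have h1 : (AdjoinSimple.gen k a ^ (p : ℕ)) • (c j • b j) = a ^ (p : ℕ) * (c j • b j) := by
        rw [Algebra.smul_def]; simp
      simp only
      rw [h1, map_mul, map_pow, pow_succ]
      refine mul_le_mul_left ?_ _
      rw [mul_comm, pow_add]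
      have hM : 1 ≤ max 1 (W.valuation a) := le_max_left _ _
      refine mul_le_mul' ((hD j W hW).trans ?_) ?_
      · exact pow_le_pow_right' hM (Finset.le_sup (Finset.mem_univ j))
      · exact (pow_le_pow_left' (le_max_right _ _) _).trans (pow_le_pow_right' hM (by omega))
    have hli' : LinearIndependent k (fun p : Fin (N + 1) × Fin r =>
        (⟨_, hmem p⟩ : E k a (D₀ + N + 1))) := by
      refine LinearIndependent.of_comp (E k a (D₀ + N + 1)).subtype ?_
      exact hli
    have := hli'.fintype_card_le_finrank
    simp only [Fintype.card_prod, Fintype.card_fin] at this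
    rw [mul_comm]
    exact this.trans e2
  by_contra! hlt
  have h := key (n * D₀)
  have h2 : (n + 1) * (n * D₀ + 1) ≤ r * (n * D₀ + 1) := Nat.mul_le_mul_right _ hlt
  nlinarith

open IntermediateField in
lemma finite_of_transcendental {k K : Type*} [Field k] [Field K] [Algebra k K] {x f : K}
    (hx : FiniteDimensional (adjoin k {x}) K) (hf : Transcendental k f) :
    FiniteDimensional (adjoin k {f}) K := by
  have e1 : Algebra.EssFiniteType k (adjoin k {x}) :=
    essFiniteType_iff.mpr (fg_adjoin_of_finite (Set.finite_singleton x))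
  have e2 : Algebra.EssFiniteType k K := Algebra.EssFiniteType.comp k (adjoin k {x}) K
  have e3 : Algebra.EssFiniteType (adjoin k {f}) K := Algebra.EssFiniteType.of_comp k _ K
  have alg : Algebra.IsAlgebraic (Algebra.adjoin k {x}) K :=
    open scoped IntermediateField.algebraAdjoinAdjoin in
    Algebra.IsAlgebraic.trans (Algebra.adjoin k {x}) (adjoin k {x}) K
  have htr : Algebra.trdeg k K ≤ 1 := by
    have := Algebra.IsAlgebraic.trdeg_le_cardinalMk k ({x} : Set K)
    simpa using this
  have hb : IsTranscendenceBasis k (fun _ : Unit => f) := by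
    refine AlgebraicIndependent.isTranscendenceBasis_of_lift_trdeg_le_of_finite
      (algebraicIndependent_unique_type_iff.mpr hf) ?_
    simpa using htr
  have := hb.isAlgebraic_field
  rw [Set.range_const] at this
  exact Algebra.finite_of_essFiniteType_of_isAlgebraic

lemma exists_coeff {k K L : Type*} [Field k] [Field K] [Field L] [Algebra k K] [Algebra k L]
    [Algebra L K] [IsScalarTower k L K] (f : K) (hf : IsIntegral L f) (hft : Transcendental k f) :
    ∃ i, Transcendental k ((minpoly L f).coeff i) := by
  by_contra! h
  simp only [Transcendental, not_not] at h
  apply hft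
  have h1 : minpoly L f ∈ Polynomial.lifts (algebraMap (integralClosure k L) L) := by
    rw [Polynomial.lifts_iff_coeff_lifts]
    intro i
    exact ⟨⟨_, (h i).isIntegral⟩, rfl⟩
  obtain ⟨q, hq, -, hm⟩ := Polynomial.lifts_and_natDegree_eq_and_monic h1 (minpoly.monic hf)
  have h2 : IsIntegral (integralClosure k L) f := by
    refine ⟨q, hm, ?_⟩
    have := minpoly.aeval L f
    rw [← hq, aeval_map_algebraMap] at this
    exact this
  exact (isIntegral_trans (R := k) f h2).isAlgebraic

end GonAux

/-- If `π : X → Y` is a dominant `k`-rational map of smooth projective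
curves over `k` (equivalently, a `k`-embedding `π : k(Y) → k(X)` of function fields, of
finite degree), then `gon_k(X) ≥ gon_k(Y)`. -/
theorem gonality_ge_of_dominant
    (k K L : Type*) [Field k] [Field K] [Field L] [Algebra k K] [Algebra k L]
    (hK : IsFunctionField k K) (hL : IsFunctionField k L)
    (π : L →ₐ[k] K) [FiniteDimensional ↥π.fieldRange K] :
    gonality k L ≤ gonality k K := by
  obtain ⟨x, hx, hxf⟩ := hK
  let : Algebra L K := π.toRingHom.toAlgebra
  have : IsScalarTower k L K := IsScalarTower.of_algebraMap_eq fun c => (π.commutes c).symm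
  refine le_csInf ⟨_, x, hx, rfl⟩ ?_
  rintro _ ⟨f, hf, rfl⟩
  have hfin := GonAux.finite_of_transcendental hxf hf
  have hint : IsIntegral L f := by
    have h1 : IsIntegral π.fieldRange f := IsIntegral.of_finite _ _
    obtain ⟨p, hp, hpf⟩ := h1
    have hs : Function.Surjective π.rangeRestrict := π.rangeRestrict_surjective
    let ρ : L →+* π.fieldRange := π.rangeRestrict.toRingHom
    have hl : p ∈ Polynomial.lifts ρ := by
      rw [Polynomial.lifts_iff_coeff_lifts]
      exact fun i => hs _
    obtain ⟨q, hq, -, hm⟩ := Polynomial.lifts_and_natDegree_eq_and_monic hl hp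
    refine ⟨q, hm, ?_⟩
    rw [← hq, Polynomial.eval₂_map] at hpf
    exact hpf
  obtain ⟨i, hi⟩ := GonAux.exists_coeff f hint hf
  refine le_trans ?_ (GonAux.finrank_le f hint hi rfl)
  exact Nat.sInf_le ⟨_, hi, rfl⟩
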